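/- arXiv:2106.03045 — 2 statements merged into one kernel-verified Lean document; each statement's English description precedes it below -/
import Mathlib

section
/- Let α, β, γ, δ ∈ ℝ with α + δ ≠ 0 and αγ = 0. For the Lie algebra 𝔤₇ with its Bott connection ∇^B, the symmetrized Ricci tensor ρ̃^B of ∇^B is NOT a Codazzi tensor for ∇^B; that is, there exist X, Y, Z ∈ {e₁,e₂,e₃} with (∇^B_X ρ̃^B)(Y,Z) ≠ (∇^B_Y ρ̃^B)(X,Z). -/
noncomputable section

/-- The underlying vector space `V = ℝ³`. -/
abbrev V : Type := Fin 3 → ℝ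

/-- The basis vector e₁. -/
def e1 : V := ![1, 0, 0]
/-- The basis vector e₂. -/
def e2 : V := ![0, 1, 0]
/-- The basis vector e₃. -/
def e3 : V := ![0, 0, 1]

/-- The Lorentzian inner product with g(e₁,e₁)=g(e₂,e₂)=1, g(e₃,e₃)=−1. -/
def gL (x y : V) : ℝ := x 0 * y 0 + x 1 * y 1 - x 2 * y 2

/-- Curvature R(X,Y)Z = ∇_X ∇_Y Z − ∇_Y ∇_X Z − ∇_{[X,Y]} Z. -/
def curv (nabla bracket : V → V → V) (x y z : V) : V :=
  nabla x (nabla y z) - nabla y (nabla x z) - nabla (bracket x y) z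

/-- Ricci tensor ρ(X,Y) = −g(R(X,e₁)Y,e₁) − g(R(X,e₂)Y,e₂) + g(R(X,e₃)Y,e₃). -/
def ricci (nabla bracket : V → V → V) (x y : V) : ℝ :=
  - gL (curv nabla bracket x e1 y) e1 - gL (curv nabla bracket x e2 y) e2
  + gL (curv nabla bracket x e3 y) e3

/-- Symmetrized Ricci tensor ρ̃(X,Y) = (ρ(X,Y) + ρ(Y,X))/2. -/
def ricciSym (nabla bracket : V → V → V) (x y : V) : ℝ :=
  (ricci nabla bracket x y + ricci nabla bracket y x) / 2

/-- Covariant derivative of a (left-invariant) bilinear form: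
(∇_X ω)(Y,Z) = −ω(∇_X Y, Z) − ω(Y, ∇_X Z). -/
def covDer (nabla : V → V → V) (ω : V → V → ℝ) (x y z : V) : ℝ :=
  - ω (nabla x y) z - ω y (nabla x z)

/-- ω is a Codazzi tensor for ∇: (∇_X ω)(Y,Z) = (∇_Y ω)(X,Z) for all X,Y,Z. -/
def IsCodazzi (nabla : V → V → V) (ω : V → V → ℝ) : Prop :=
  ∀ x y z : V, covDer nabla ω x y z = covDer nabla ω y x z

/-- Torsion T(X,Y) = ∇_X Y − ∇_Y X − [X,Y]. -/
def torsion (nabla bracket : V → V → V) (x y : V) : V :=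
  nabla x y - nabla y x - bracket x y

/-- (V,∇,ω) is a quasi-statistical structure:
(∇_X ω)(Y,Z) − (∇_Y ω)(X,Z) + ω(T(X,Y),Z) = 0 for all X,Y,Z. -/
def IsQuasiStatistical (nabla bracket : V → V → V) (ω : V → V → ℝ) : Prop :=
  ∀ x y z : V,
    covDer nabla ω x y z - covDer nabla ω y x z + ω (torsion nabla bracket x y) z = 0

/-- The Lie bracket of the Lie algebra 𝔤7. -/
def bracket (α β γ δ : ℝ) (x y : V) : V :=
  ![ (x 0 * y 1 - x 1 * y 0) * (-α) + (x 0 * y 2 - x 2 * y 0) * (α) + (x 1 * y 2 - x 2 * y 1) * (γ),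
     (x 0 * y 1 - x 1 * y 0) * (-β) + (x 0 * y 2 - x 2 * y 0) * (β) + (x 1 * y 2 - x 2 * y 1) * (δ),
     (x 0 * y 1 - x 1 * y 0) * (-β) + (x 0 * y 2 - x 2 * y 0) * (β) + (x 1 * y 2 - x 2 * y 1) * (δ) ]

/-- The Bott connection ∇^B of 𝔤7. -/
def nabla (α β γ δ : ℝ) (x y : V) : V :=
  ![ x 0 * y 1 * (-α) + x 1 * y 1 * (-β) + x 2 * y 0 * (-α) + x 2 * y 1 * (-γ),
     x 0 * y 0 * (α) + x 1 * y 0 * (β) + x 2 * y 0 * (-β) + x 2 * y 1 * (-δ),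
     x 0 * y 2 * (β) + x 1 * y 2 * (δ) ]

theorem stmt5 (α β γ δ : ℝ) (h1 : α + δ ≠ 0) (h2 : α * γ = 0) :
    ∃ x ∈ ({e1, e2, e3} : Set V), ∃ y ∈ ({e1, e2, e3} : Set V),
      ∃ z ∈ ({e1, e2, e3} : Set V),
        covDer (nabla α β γ δ) (ricciSym (nabla α β γ δ) (bracket α β γ δ)) x y z ≠ covDer (nabla α β γ δ) (ricciSym (nabla α β γ δ) (bracket α β γ δ)) y x z := by
  by_contra! h
  have h121 := h e1 (by simp) e2 (by simp) e1 (by simp)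
  have h123 := h e1 (by simp) e2 (by simp) e3 (by simp)
  have h131 := h e1 (by simp) e3 (by simp) e1 (by simp)
  have h233 := h e2 (by simp) e3 (by simp) e3 (by simp)
  clear h
  simp [covDer, ricciSym, ricci, curv, gL, nabla, bracket, e1, e2, e3]
    at h121 h123 h131 h233
  have hδβ : δ * β ^ 2 = 0 := by linear_combination h121 - β * h2
  rcases mul_eq_zero.mp hδβ with rfl | hβ
  · have hα : α ≠ 0 := by simpa using h1
    have hγ : γ = 0 := (mul_eq_zero.mp h2).resolve_left hα
    subst hγ
    have hβ : β = 0 := by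
      have : α ^ 2 * β = 0 := by linear_combination h123
      exact (mul_eq_zero.mp this).resolve_left (pow_ne_zero 2 hα)
    subst hβ
    have : α ^ 3 = 0 := by linear_combination h131 / 2
    exact pow_ne_zero 3 hα this
  · obtain rfl : β = 0 := by simpa using hβ
    have hδ : δ ^ 2 * (α + 2 * δ) = 0 := by linear_combination -h233
    rcases mul_eq_zero.mp hδ with hδ | hδ
    · obtain rfl : δ = 0 := by simpa using hδ
      have : α ^ 3 = 0 := by linear_combination h131 / 2
      exact h1 (by simpa using this)
    · obtain rfl : α = -2 * δ := by linear_combination hδ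
      have : δ ^ 3 = 0 := by linear_combination -h131 / 16
      obtain rfl : δ = 0 := by simpa using this
      exact h1 (by simp)

end
end

section
/- Let α, β, γ, δ ∈ ℝ with α + δ ≠ 0 and αγ = 0. For the Lie algebra 𝔤₇ with its Bott connection ∇^B and symmetrized Ricci tensor ρ̃^B, the triple (𝔤₇, ∇^B, ρ̃^B) is NOT a quasi-statistical structure; that is, there exist X, Y, Z ∈ {e₁,e₂,e₃} with (∇^B_X ρ̃^B)(Y,Z) − (∇^B_Y ρ̃^B)(X,Z) + ρ̃^B(T^B(X,Y), Z) ≠ 0. -/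
noncomputable section

theorem stmt12 (α β γ δ : ℝ) (h1 : α + δ ≠ 0) (h2 : α * γ = 0) :
    ∃ x ∈ ({e1, e2, e3} : Set V), ∃ y ∈ ({e1, e2, e3} : Set V),
      ∃ z ∈ ({e1, e2, e3} : Set V),
        covDer (nabla α β γ δ) (ricciSym (nabla α β γ δ) (bracket α β γ δ)) x y z - covDer (nabla α β γ δ) (ricciSym (nabla α β γ δ) (bracket α β γ δ)) y x z
          + (ricciSym (nabla α β γ δ) (bracket α β γ δ)) (torsion (nabla α β γ δ) (bracket α β γ δ) x y) z ≠ 0 := by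
  by_contra! hqs
  have h123 := hqs e1 (by simp) e2 (by simp) e3 (by simp)
  have h131 := hqs e1 (by simp) e3 (by simp) e1 (by simp)
  have h232 := hqs e2 (by simp) e3 (by simp) e2 (by simp)
  have h233 := hqs e2 (by simp) e3 (by simp) e3 (by simp)
  simp [covDer, ricciSym, ricci, curv, torsion, nabla, bracket, gL, e1, e2, e3]
    at h123 h131 h232 h233
  have hβ : β = 0 := by
    have : β * (α + δ) ^ 2 = 0 := by grind
    simpa [h1] using this
  subst hβ
  have hquad : 2 * α ^ 2 - α * δ / 2 - δ ^ 2 = 0 := by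
    have : (α + δ) * (2 * α ^ 2 - α * δ / 2 - δ ^ 2) = 0 := by grind
    simpa [h1] using this
  have hδ : δ ^ 2 * (α + 2 * δ) = 0 := by grind
  grind

end
end
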